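/- arXiv:2303.03138 — 3 statements merged into one kernel-verified Lean document; each statement's English description precedes it below -/
import Mathlib

section
/- Let c ≠ ±1 be a squarefree integer such that f(x) = x^7 + c·(x^2 + 2x + 1) ∈ ℤ[x] is irreducible, let θ be a root of f, K = ℚ(θ), and ℤ_K the ring of integers of K. Then the discriminant of f is D_f = c^6·(4·5^5·c − 7^7), and every prime p dividing c does not divide the index [ℤ_K : ℤ[θ]]; moreover ℤ_K = ℤ[θ] if and only if for each prime p dividing D_f with p not dividing c, p^2 does not divide 4·5^5·c − 7^7. -/
open Polynomial NumberField

/-- The discriminant of a monic integer polynomial `f`, defined as the discriminant of the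
power basis of `ℤ[X]/(f)` (junk value `0` if `f` is not monic). -/
noncomputable def polyDisc (f : Polynomial ℤ) : ℤ :=
  if hf : f.Monic then Algebra.discr ℤ (AdjoinRoot.powerBasis' hf).basis else 0

/-- The index `[ℤ_K : ℤ[θ]]` of the order generated by `θ` in the ring of integers. -/
noncomputable def polyIndex {K : Type*} [Field K] [NumberField K] (θ : 𝓞 K) : ℕ :=
  ((Algebra.adjoin ℤ {θ}).toSubring.toAddSubgroup).index

open Module in
lemma algebraMap_discr_eq_discr {ι R S R' S' : Type*} [Fintype ι] [DecidableEq ι]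
    [CommRing R] [CommRing S] [Algebra R S] [CommRing R'] [CommRing S'] [Algebra R' S']
    [Algebra R R'] (b : Basis ι R S) (b' : Basis ι R' S') (φ : S →+* S')
    (hφ : ∀ r, φ (algebraMap R S r) = algebraMap R' S' (algebraMap R R' r))
    (hb : ∀ i, φ (b i) = b' i) :
    algebraMap R R' (Algebra.discr R b) = Algebra.discr R' b' := by
  have hrepr (x : S) (i : ι) : b'.repr (φ x) i = algebraMap R R' (b.repr x i) := by
    have hx : φ x = ∑ j, algebraMap R R' (b.repr x j) • b' j := by
      conv_lhs => rw [← b.sum_repr x]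
      simp only [map_sum, Algebra.smul_def, map_mul, hφ, hb]
    rw [hx, b'.repr_sum_self]
  have htrace (x : S) : Algebra.trace R' S' (φ x) = algebraMap R R' (Algebra.trace R S x) := by
    rw [Algebra.trace_eq_matrix_trace b, Algebra.trace_eq_matrix_trace b', Matrix.trace,
      Matrix.trace, map_sum]
    refine Finset.sum_congr rfl fun i _ ↦ ?_
    rw [Matrix.diag_apply, Matrix.diag_apply, Algebra.leftMulMatrix_eq_repr_mul,
      Algebra.leftMulMatrix_eq_repr_mul, ← hb, ← map_mul, hrepr]
  rw [Algebra.discr_def, Algebra.discr_def, RingHom.map_det]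
  congr 1
  ext i j
  simp only [RingHom.mapMatrix_apply, Matrix.map_apply, Algebra.traceMatrix_apply,
    Algebra.traceForm_apply, ← hb, ← map_mul, htrace]

lemma norm_algebraMap_sub_gen {F L : Type*} [Field F] [Field L] [Algebra F L]
    (pb : PowerBasis F L) (a : F) :
    Algebra.norm F (algebraMap F L a - pb.gen) = (minpoly F pb.gen).eval a := by
  rw [← charpoly_leftMulMatrix, Matrix.eval_charpoly, Algebra.norm_eq_matrix_det pb.basis,
    map_sub, AlgHom.commutes]
  rfl

lemma coe_mem_adjoin_coe_iff {K : Type*} [Field K] (θ α : 𝓞 K) :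
    (α : K) ∈ Algebra.adjoin ℤ {(θ : K)} ↔ α ∈ Algebra.adjoin ℤ {θ} := by
  have h : Algebra.adjoin ℤ {(θ : K)} =
      (Algebra.adjoin ℤ {θ}).map (IsScalarTower.toAlgHom ℤ (𝓞 K) K) := by
    rw [AlgHom.map_adjoin_singleton]
    rfl
  rw [h, Subalgebra.mem_map]
  refine ⟨?_, fun hα ↦ ⟨α, hα, rfl⟩⟩
  rintro ⟨β, hβ, hαβ⟩
  rwa [← RingOfIntegers.coe_injective hαβ]

lemma isIntegral_div_of_sq_dvd_eval {L : Type*} [Field L] [CharZero L] {f : ℤ[X]} {p r : ℤ}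
    (hp : p ≠ 0) (h : p ^ 2 ∣ f.eval r) (h' : p ∣ f.derivative.eval r)
    {x : L} (hx : IsIntegral ℤ x) (hfx : aeval x f = 0) :
    IsIntegral ℤ (aeval x (f /ₘ (X - C r)) / (p : L)) := by
  set q := f /ₘ (X - C r)
  set s := q /ₘ (X - C r)
  have hf : C (f.eval r) + (X - C r) * q = f := by
    rw [← modByMonic_X_sub_C_eq_C_eval, modByMonic_add_div]
  have hq : C (q.eval r) + (X - C r) * s = q := by
    rw [← modByMonic_X_sub_C_eq_C_eval, modByMonic_add_div]
  have hqr : q.eval r = f.derivative.eval r := by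
    conv_rhs => rw [← hf]
    simp
  obtain ⟨a, ha⟩ := h
  obtain ⟨b, hb⟩ := h'
  have hf' := congrArg (aeval x) hf
  have hq' := congrArg (aeval x) hq
  rw [hqr, hb] at hq'
  rw [ha, hfx] at hf'
  simp only [map_add, map_mul, map_sub, map_pow, aeval_X, map_intCast, eq_intCast] at hf' hq'
  have hs : IsIntegral ℤ (aeval x s) := IsIntegral.of_mem_of_fg _
    hx.fg_adjoin_singleton _ (aeval_mem_adjoin_singleton ℤ x)
  have hp' : (p : L) ≠ 0 := Int.cast_ne_zero.2 hp
  set y := aeval x q / (p : L)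
  have hy : aeval x q = p * y := by simp only [y]; field_simp
  have hroot : y ^ 2 - b * y + a * aeval x s = 0 := by
    rw [hy] at hf' hq'
    have : (p : L) ^ 2 * (y ^ 2 - b * y + a * aeval x s) = 0 := by
      linear_combination (-p * y) * hq' + aeval x s * hf'
    exact (mul_eq_zero.1 this).resolve_left (pow_ne_zero 2 hp')
  let A := integralClosure ℤ L
  refine isIntegral_trans (A := A) (R := ℤ) y ?_
  let t : A := ⟨aeval x s, hs⟩
  refine ⟨X ^ 2 + (- C (b : A) * X + C ((a : A) * t)), ?_, ?_⟩
  · monicity!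
  · rw [← aeval_def]
    have ht : algebraMap A L t = aeval x s := rfl
    simp only [map_add, map_mul, map_neg, map_pow, aeval_X, aeval_C, map_intCast, ht]
    linear_combination hroot

section

variable {K : Type*} [Field K] [NumberField K]

lemma polyDisc_minpoly (θ : 𝓞 K) (pb : PowerBasis ℚ K) (hpb : pb.gen = θ) :
    (polyDisc (minpoly ℤ (θ : K)) : ℚ) = Algebra.discr ℚ pb.basis := by
  have hint : IsIntegral ℤ (θ : K) := θ.isIntegral_coe
  have hmonic := minpoly.monic hint
  have hdim : pb.dim = (minpoly ℤ (θ : K)).natDegree := by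
    rw [← pb.natDegree_minpoly, hpb, minpoly.isIntegrallyClosed_eq_field_fractions' ℚ hint,
      hmonic.natDegree_map]
  let e := finCongr hdim
  rw [polyDisc, dif_pos hmonic, ← Algebra.discr_reindex ℚ pb.basis e,
    ← Module.Basis.coe_reindex]
  let φ : AdjoinRoot (minpoly ℤ (θ : K)) →ₐ[ℤ] K :=
    AdjoinRoot.liftAlgHom _ (Algebra.ofId ℤ K) (θ : K)
      (by simpa [Polynomial.aeval_def] using minpoly.aeval ℤ (θ : K))
  refine algebraMap_discr_eq_discr (R := ℤ) (R' := ℚ) _ (pb.basis.reindex e) φ.toRingHom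
    (fun r ↦ by simp) fun i ↦ ?_
  have hi : (AdjoinRoot.powerBasis' hmonic).basis i = AdjoinRoot.root _ ^ (i : ℕ) :=
    (AdjoinRoot.powerBasis' hmonic).basis_eq_pow i
  rw [Module.Basis.reindex_apply, pb.basis_eq_pow, hpb]
  refine (congrArg φ hi).trans ?_
  simp [φ, e]

lemma polyIndex_sq_mul_discr (θ : 𝓞 K) (pb : PowerBasis ℚ K) (hpb : pb.gen = θ) :
    (polyIndex θ : ℚ) ^ 2 * discr K = Algebra.discr ℚ pb.basis := by
  classical
  have hint : IsIntegral ℤ θ := Algebra.IsIntegral.isIntegral θ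
  have hdim : pb.dim = (minpoly ℤ θ).natDegree := by
    rw [← pb.natDegree_minpoly, hpb]
    change (minpoly ℚ (algebraMap (𝓞 K) K θ)).natDegree = _
    rw [minpoly.isIntegrallyClosed_eq_field_fractions ℚ K hint,
      (minpoly.monic hint).natDegree_map]
  have hcard : Fintype.card (Module.Free.ChooseBasisIndex ℤ (𝓞 K)) =
      Fintype.card (Fin (minpoly ℤ θ).natDegree) := by
    rw [← Module.finrank_eq_card_chooseBasisIndex, RingOfIntegers.rank, pb.finrank, hdim,
      Fintype.card_fin]
  let e := Fintype.equivOfCardEq hcard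
  let e' := finCongr hdim
  let b := (RingOfIntegers.basis K).reindex e
  obtain ⟨bN, hbN⟩ : ∃ bN : Module.Basis (Fin (minpoly ℤ θ).natDegree) ℤ
      (Algebra.adjoin ℤ {θ}), ∀ j, (bN j : 𝓞 K) = θ ^ (j : ℕ) := by
    refine ⟨(Algebra.adjoin.powerBasis' hint).basis, fun j ↦ ?_⟩
    refine (congrArg Subtype.val ((Algebra.adjoin.powerBasis' hint).basis_eq_pow j)).trans ?_
    simp
  have hindex : (b.det ((↑) ∘ bN)).natAbs = polyIndex θ :=
    Submodule.natAbs_det_basis_change b (Subalgebra.toSubmodule (Algebra.adjoin ℤ {θ})) bN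
  let w := (integralBasis K).reindex e
  have hw : discr K = Algebra.discr ℚ w := by
    rw [coe_discr, Module.Basis.coe_reindex, Algebra.discr_reindex]
  have hmat : w.toMatrix (pb.basis.reindex e') =
      (b.toMatrix ((↑) ∘ bN)).map (algebraMap ℤ ℚ) := by
    ext i j
    have : (pb.basis.reindex e') j = algebraMap (𝓞 K) K (bN j : 𝓞 K) := by
      simp [hbN, e', hpb]
    simp only [Matrix.map_apply, Module.Basis.toMatrix_apply, this, w, b,
      Module.Basis.repr_reindex_apply, integralBasis_repr_apply, Function.comp]
  have hdet : (w.toMatrix (pb.basis.reindex e')).det = (b.det ((↑) ∘ bN) : ℤ) := by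
    rw [hmat, Module.Basis.det_apply, ← RingHom.mapMatrix_apply, ← RingHom.map_det]
    rfl
  rw [← Algebra.discr_reindex ℚ pb.basis e', ← Module.Basis.coe_reindex,
    ← w.toMatrix_map_vecMul (pb.basis.reindex e'), Algebra.discr_of_matrix_vecMul, hdet, ← hw,
    ← hindex, Nat.cast_natAbs, Int.cast_abs, sq_abs]

lemma exists_prime_smul_mem_adjoin (θ : 𝓞 K) {p : ℕ} (hp : p.Prime) (h0 : polyIndex θ ≠ 0)
    (h : p ∣ polyIndex θ) :
    ∃ α : 𝓞 K, α ∉ Algebra.adjoin ℤ {θ} ∧ p • α ∈ Algebra.adjoin ℤ {θ} := by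
  have : Fact p.Prime := ⟨hp⟩
  set H := (Algebra.adjoin ℤ {θ}).toSubring.toAddSubgroup
  have : Finite (𝓞 K ⧸ H) := Nat.finite_of_card_ne_zero h0
  obtain ⟨x, hx⟩ := exists_prime_addOrderOf_dvd_card' (G := 𝓞 K ⧸ H) p h
  obtain ⟨α, rfl⟩ := QuotientAddGroup.mk_surjective x
  refine ⟨α, fun hα ↦ ?_, ?_⟩
  · rw [(QuotientAddGroup.eq_zero_iff α).2 hα, addOrderOf_zero] at hx
    exact hp.one_lt.ne hx
  · have h1 := addOrderOf_nsmul_eq_zero (α : 𝓞 K ⧸ H)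
    rw [hx, ← QuotientAddGroup.mk_nsmul, QuotientAddGroup.eq_zero_iff] at h1
    exact h1

lemma polyIndex_eq_one_iff (θ : 𝓞 K) : polyIndex θ = 1 ↔ Algebra.adjoin ℤ {θ} = ⊤ := by
  rw [polyIndex, AddSubgroup.index_eq_one, SetLike.ext_iff, SetLike.ext_iff]
  rfl

lemma not_dvd_polyIndex_of_isEisensteinAt (θ : 𝓞 K) (hgen : Algebra.adjoin ℚ {(θ : K)} = ⊤)
    (h0 : polyIndex θ ≠ 0) {p : ℕ} (hp : p.Prime)
    (hei : (minpoly ℤ (θ : K)).IsEisensteinAt (Ideal.span {(p : ℤ)})) :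
    ¬ p ∣ polyIndex θ := by
  intro hdvd
  obtain ⟨α, hα, hpα⟩ := exists_prime_smul_mem_adjoin θ hp h0 hdvd
  refine hα ((coe_mem_adjoin_coe_iff θ α).1 ?_)
  rw [← coe_mem_adjoin_coe_iff] at hpα
  let pb := PowerBasis.ofAdjoinEqTop (Algebra.IsIntegral.isIntegral (R := ℚ) (θ : K)) hgen
  refine mem_adjoin_of_smul_prime_smul_of_minpoly_isEisensteinAt (R := ℤ) (B := pb)
    (Nat.prime_iff_prime_int.1 hp) θ.isIntegral_coe α.isIntegral_coe ?_ hei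
  change (p : ℤ) • (α : K) ∈ Algebra.adjoin ℤ {(θ : K)}
  rwa [natCast_zsmul, ← map_nsmul]

lemma adjoin_ne_top_of_sq_dvd_eval (θ : 𝓞 K) {f : ℤ[X]} (hf : minpoly ℤ (θ : K) = f)
    {p : ℕ} (hp : p.Prime) {r : ℤ} (h : (p : ℤ) ^ 2 ∣ f.eval r)
    (h' : (p : ℤ) ∣ f.derivative.eval r) : Algebra.adjoin ℤ {θ} ≠ ⊤ := by
  intro htop
  have : Fact p.Prime := ⟨hp⟩
  have hint : IsIntegral ℤ (θ : K) := θ.isIntegral_coe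
  have hmonic : f.Monic := hf ▸ minpoly.monic hint
  have hdeg : 0 < f.natDegree := hf ▸ minpoly.natDegree_pos hint
  have hfθ : aeval (θ : K) f = 0 := hf ▸ minpoly.aeval ℤ (θ : K)
  set q := f /ₘ (X - C r) with hq
  have hqdeg : q.natDegree < f.natDegree := by
    rw [hq, natDegree_divByMonic _ (monic_X_sub_C r), natDegree_X_sub_C]
    omega
  have hqmonic : q.Monic := by
    rw [Monic, hq, leadingCoeff_divByMonic_of_monic (monic_X_sub_C r), hmonic.leadingCoeff]
    rw [degree_X_sub_C, degree_eq_natDegree hmonic.ne_zero]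
    exact_mod_cast hdeg
  have hp0 : (p : ℤ) ≠ 0 := by exact_mod_cast hp.ne_zero
  obtain ⟨α, hα⟩ := (IsIntegralClosure.isIntegral_iff (A := 𝓞 K)).1
    (isIntegral_div_of_sq_dvd_eval hp0 h h' hint hfθ)
  have hα' : α ∈ Algebra.adjoin ℤ {θ} := htop ▸ Algebra.mem_top
  rw [← coe_mem_adjoin_coe_iff, Algebra.adjoin_singleton_eq_range_aeval] at hα'
  obtain ⟨g, hg⟩ := hα'
  have hpg : aeval (θ : K) (C (p : ℤ) * g - q) = 0 := by
    have hpK : (p : K) ≠ 0 := Nat.cast_ne_zero.2 hp.ne_zero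
    have hg' : aeval (θ : K) g = aeval (θ : K) q / (p : K) := by
      rw [← Int.cast_natCast (R := K) p]
      exact hg.trans hα
    rw [map_sub, map_mul, hg', aeval_C]
    simp only [map_natCast]
    field_simp
    ring
  have hdvd : f ∣ C (p : ℤ) * g - q := hf ▸ minpoly.isIntegrallyClosed_dvd hint hpg
  have hdvd' := Polynomial.map_dvd (Int.castRingHom (ZMod p)) hdvd
  rw [Polynomial.map_sub, Polynomial.map_mul, map_C] at hdvd'
  simp only [eq_intCast, Int.cast_natCast, CharP.cast_eq_zero, map_zero, zero_mul, zero_sub,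
    dvd_neg] at hdvd'
  refine (hmonic.map _).not_dvd_of_natDegree_lt (hqmonic.map _).ne_zero ?_ hdvd'
  rwa [hmonic.natDegree_map, hqmonic.natDegree_map]

lemma discr_powerBasis_septic {c : ℤ} (hc : c ≠ 0) (pb : PowerBasis ℚ K)
    (hmin : minpoly ℚ pb.gen = X ^ 7 + C (c : ℚ) * X ^ 2 + C (2 * c : ℚ) * X + C (c : ℚ)) :
    Algebra.discr ℚ pb.basis = c ^ 6 * (4 * 5 ^ 5 * c - 7 ^ 7) := by
  have hdim : pb.dim = 7 := by
    rw [← pb.natDegree_minpoly, hmin]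
    compute_degree!
  have hfin : Module.finrank ℚ K = 7 := by rw [pb.finrank, hdim]
  have hroot := minpoly.aeval ℚ pb.gen
  have hnorm (a : ℚ) := norm_algebraMap_sub_gen pb a
  rw [Algebra.discr_powerBasis_eq_norm, hfin]
  have hderiv : aeval pb.gen (derivative (minpoly ℚ pb.gen)) =
      7 * pb.gen ^ 6 + 2 * c * pb.gen + 2 * c := by
    simp [hmin]
    ring
  have hd : (algebraMap ℚ K 0 - pb.gen) * aeval pb.gen (derivative (minpoly ℚ pb.gen)) =
      algebraMap ℚ K (5 * c) *
        ((algebraMap ℚ K (-1) - pb.gen) * (algebraMap ℚ K (-7 / 5) - pb.gen)) := by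
    rw [hderiv]
    rw [hmin] at hroot
    simp at hroot ⊢
    linear_combination (-7) * hroot
  have hN := congrArg (Algebra.norm ℚ) hd
  rw [map_mul, map_mul (Algebra.norm ℚ), map_mul (Algebra.norm ℚ), hnorm, hnorm, hnorm,
    Algebra.norm_algebraMap, hfin] at hN
  simp only [hmin, eval_add, eval_mul, eval_pow, eval_X, eval_C] at hN ⊢
  have hcQ : (c : ℚ) ≠ 0 := by exact_mod_cast hc
  apply mul_left_cancel₀ hcQ
  norm_num at hN ⊢
  linear_combination (-1) * hN

end

lemma isEisensteinAt_septic {c p : ℤ} (hp : Prime p) (hc : Squarefree c) (hpc : p ∣ c)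
    {f : ℤ[X]} (hf : f = X ^ 7 + C c * X ^ 2 + C (2 * c) * X + C c) :
    f.IsEisensteinAt (Ideal.span {p}) := by
  have hdeg : f.natDegree = 7 := by rw [hf]; compute_degree!
  have hmonic : f.Monic := by rw [hf]; monicity!
  refine ⟨?_, fun {n} hn ↦ ?_, ?_⟩
  · rw [hmonic.leadingCoeff, Ideal.mem_span_singleton]
    exact fun h ↦ hp.not_isUnit (isUnit_of_dvd_one h)
  · rw [hdeg] at hn
    rw [Ideal.mem_span_singleton, hf]
    simp only [coeff_add, coeff_C_mul, coeff_X_pow, coeff_X, coeff_C]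
    interval_cases n <;> norm_num [hpc, hpc.mul_left]
  · rw [Ideal.span_singleton_pow, Ideal.mem_span_singleton, hf]
    simp only [coeff_add, coeff_C_mul, coeff_X_pow, coeff_X, coeff_C]
    norm_num
    exact fun h ↦ hp.not_isUnit (hc p (by rwa [← sq]))

lemma exists_sq_dvd_eval_septic {c : ℤ} {p : ℕ} (hp : p.Prime)
    (h : (p : ℤ) ^ 2 ∣ 4 * 5 ^ 5 * c - 7 ^ 7)
    {f : ℤ[X]} (hf : f = X ^ 7 + C c * X ^ 2 + C (2 * c) * X + C c) :
    ∃ r : ℤ, (p : ℤ) ^ 2 ∣ f.eval r ∧ (p : ℤ) ^ 2 ∣ f.derivative.eval r := by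
  have hcop : IsCoprime ((p : ℤ) ^ 2) 5 := by
    refine IsCoprime.pow_left (Nat.isCoprime_iff_coprime.2 ?_)
    rw [Nat.coprime_primes hp Nat.prime_five]
    rintro rfl
    have := (dvd_pow_self (5 : ℤ) two_ne_zero).trans h
    omega
  obtain ⟨u, v, huv⟩ := hcop
  have hr : 5 * (-7 * v) ≡ -7 [ZMOD (p : ℤ) ^ 2] :=
    (Int.modEq_iff_dvd.2 ⟨-7 * u, by linear_combination 7 * huv⟩)
  generalize -7 * v = r at hr
  have h5 : IsCoprime ((p : ℤ) ^ 2) 5 := ⟨u, v, huv⟩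
  refine ⟨r, h5.pow_right (n := 7) |>.dvd_of_dvd_mul_left ?_,
    h5.pow_right (n := 6) |>.dvd_of_dvd_mul_left ?_⟩
  · have h1 := ((hr.pow 7).add (((hr.add_right 5).pow 2).mul_left (5 ^ 5 * c))).dvd
    have h2 : 5 ^ 7 * f.eval r = (4 * 5 ^ 5 * c - 7 ^ 7) -
        ((-7) ^ 7 + 5 ^ 5 * c * (-7 + 5) ^ 2 - ((5 * r) ^ 7 + 5 ^ 5 * c * (5 * r + 5) ^ 2)) := by
      simp [hf]
      ring
    rw [h2]
    exact dvd_sub h h1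
  · have h1 := (((hr.pow 6).mul_left 7).add ((hr.add_right 5).mul_left (2 * 5 ^ 5 * c))).dvd
    have h2 : 5 ^ 6 * f.derivative.eval r = -(4 * 5 ^ 5 * c - 7 ^ 7) -
        (7 * (-7) ^ 6 + 2 * 5 ^ 5 * c * (-7 + 5) -
          (7 * (5 * r) ^ 6 + 2 * 5 ^ 5 * c * (5 * r + 5))) := by
      simp [hf]
      ring
    rw [h2]
    exact dvd_sub (h.neg_right) h1

theorem stmt_13 (c : ℤ) (hc1 : c ≠ 1) (hc1' : c ≠ -1) (hcsf : Squarefree c)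
    (f : Polynomial ℤ) (hf : f = X ^ 7 + C c * X ^ 2 + C (2 * c) * X + C c)
    (hirr : Irreducible f)
    (K : Type*) [Field K] [NumberField K] (θ : 𝓞 K)
    (hroot : Polynomial.aeval (θ : K) f = 0)
    (hgen : Algebra.adjoin ℚ {(θ : K)} = ⊤) :
    polyDisc f = c ^ 6 * (4 * 5 ^ 5 * c - 7 ^ 7) ∧
    (∀ p : ℕ, p.Prime → (p : ℤ) ∣ c → ¬ (p ∣ polyIndex θ)) ∧
    (Algebra.adjoin ℤ {θ} = ⊤ ↔
      ∀ p : ℕ, p.Prime → (p : ℤ) ∣ polyDisc f → ¬ (p : ℤ) ∣ c →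
        ¬ (p : ℤ) ^ 2 ∣ (4 * 5 ^ 5 * c - 7 ^ 7)) := by
  have hint : IsIntegral ℤ (θ : K) := θ.isIntegral_coe
  have hmonic : f.Monic := by rw [hf]; monicity!
  have hmin : minpoly ℤ (θ : K) = f :=
    eq_of_monic_of_associated (minpoly.monic hint) hmonic
      ((minpoly.irreducible hint).associated_of_dvd hirr
        (minpoly.isIntegrallyClosed_dvd hint hroot))
  let pb := PowerBasis.ofAdjoinEqTop (Algebra.IsIntegral.isIntegral (R := ℚ) (θ : K)) hgen
  have hpb : pb.gen = θ := rfl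
  have hminQ : minpoly ℚ pb.gen =
      X ^ 7 + C (c : ℚ) * X ^ 2 + C (2 * c : ℚ) * X + C (c : ℚ) := by
    rw [hpb, minpoly.isIntegrallyClosed_eq_field_fractions' ℚ hint, hmin, hf]
    simp only [Polynomial.map_add, Polynomial.map_mul, Polynomial.map_pow, map_X, map_C,
      algebraMap_int_eq, Int.coe_castRingHom, Int.cast_mul, Int.cast_ofNat]
  have hc0 : c ≠ 0 := hcsf.ne_zero
  have hdiscQ := discr_powerBasis_septic hc0 pb hminQ
  have hdisc : polyDisc f = c ^ 6 * (4 * 5 ^ 5 * c - 7 ^ 7) := by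
    have h := polyDisc_minpoly θ pb hpb
    rw [hmin, hdiscQ] at h
    exact_mod_cast h
  have hindex : (polyIndex θ : ℤ) ^ 2 * discr K = c ^ 6 * (4 * 5 ^ 5 * c - 7 ^ 7) := by
    have h := polyIndex_sq_mul_discr θ pb hpb
    rw [hdiscQ] at h
    exact_mod_cast h
  have hindex0 : polyIndex θ ≠ 0 := by
    intro h0
    rw [h0, Nat.cast_zero, zero_pow two_ne_zero, zero_mul, eq_comm, mul_eq_zero] at hindex
    rcases hindex with h | h
    · exact pow_ne_zero 6 hc0 h
    · omega
  have hramified (p : ℕ) (hp : p.Prime) (hpc : (p : ℤ) ∣ c) : ¬ p ∣ polyIndex θ :=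
    not_dvd_polyIndex_of_isEisensteinAt θ hgen hindex0 hp
      (hmin ▸ isEisensteinAt_septic (Nat.prime_iff_prime_int.1 hp) hcsf hpc hf)
  refine ⟨hdisc, hramified, fun htop p hp _ _ hsq ↦ ?_, fun h ↦ ?_⟩
  · obtain ⟨r, hr, hr'⟩ := exists_sq_dvd_eval_septic hp hsq hf
    exact adjoin_ne_top_of_sq_dvd_eval θ hmin hp hr ((dvd_pow_self _ two_ne_zero).trans hr') htop
  · rw [← polyIndex_eq_one_iff]
    by_contra hne
    obtain ⟨p, hp, hdvd⟩ := Nat.exists_prime_and_dvd hne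
    have hpc : ¬ (p : ℤ) ∣ c := fun hpc ↦ hramified p hp hpc hdvd
    have hsq : (p : ℤ) ^ 2 ∣ c ^ 6 * (4 * 5 ^ 5 * c - 7 ^ 7) :=
      hindex ▸ (pow_dvd_pow_of_dvd (Int.natCast_dvd_natCast.2 hdvd) 2).mul_right _
    refine h p hp (hdisc ▸ (dvd_pow_self _ two_ne_zero).trans hsq) hpc ?_
    have hcop : IsCoprime (p : ℤ) c :=
      ((Nat.prime_iff_prime_int.1 hp).irreducible.coprime_iff_not_dvd).2 hpc
    exact hcop.pow.dvd_of_dvd_mul_left hsq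
end

section
/- Let θ be a root of the irreducible polynomial f(x) = x^7 + 7·x^2 + 14·x + 7 ∈ ℤ[x] and K = ℚ(θ). Then the absolute value of the discriminant of f is |D_f| = 7^7 · 11^3 · 79, and the index of ℤ[θ] in the ring of integers ℤ_K of K equals 11. -/
open Polynomial NumberField

/-- The companion matrix of `X ^ 7 + 7 * X ^ 2 + 14 * X + 7`. -/
def companionMatrix : Matrix (Fin 7) (Fin 7) ℤ :=
  !![0, 0, 0, 0, 0, 0, -7;
     1, 0, 0, 0, 0, 0, -14;
     0, 1, 0, 0, 0, 0, -7;
     0, 0, 1, 0, 0, 0, 0;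
     0, 0, 0, 1, 0, 0, 0;
     0, 0, 0, 0, 1, 0, 0;
     0, 0, 0, 0, 0, 1, 0]

/-- The Hankel matrix of the power sums of the roots of `X ^ 7 + 7 * X ^ 2 + 14 * X + 7`. -/
def powerSumMatrix : Matrix (Fin 7) (Fin 7) ℤ :=
  !![7, 0, 0, 0, 0, -35, -84;
     0, 0, 0, 0, -35, -84, -49;
     0, 0, 0, -35, -84, -49, 0;
     0, 0, -35, -84, -49, 0, 0;
     0, -35, -84, -49, 0, 0, 245;
     -35, -84, -49, 0, 0, 245, 1078;
     -84, -49, 0, 0, 245, 1078, 1764]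

theorem det_powerSumMatrix : powerSumMatrix.det = -(7 ^ 7 * 11 ^ 3 * 79) := by
  simp [powerSumMatrix, Matrix.det_succ_row_zero, Fin.sum_univ_succ, Fin.succAbove]

theorem trace_companionMatrix_pow (i j : Fin 7) :
    (companionMatrix ^ (i + j : ℕ)).trace = powerSumMatrix i j := by
  fin_cases i <;> fin_cases j <;> decide +kernel

section PowerBasis

variable {R S : Type*} [CommRing R] [CommRing S] [Algebra R S]

theorem leftMulMatrix_eq_companionMatrix {x : S} (b : Module.Basis (Fin 7) R S)
    (hb : ∀ i, b i = x ^ (i : ℕ)) (hx : x ^ 7 + 7 * x ^ 2 + 14 * x + 7 = 0) :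
    Algebra.leftMulMatrix b x = companionMatrix.map (Int.castRingHom R) := by
  have hlast : x * x ^ 6 = (-7 : R) • b 0 + (-14 : R) • b 1 + (-7 : R) • b 2 := by
    simp only [hb, Algebra.smul_def, map_neg, map_ofNat]
    simp
    linear_combination hx
  have hstep (j k : Fin 7) (h : (k : ℕ) = j + 1) : x * b j = b k := by
    rw [hb, hb, h, pow_succ']
  ext i j
  rw [Algebra.leftMulMatrix_eq_repr_mul]
  fin_cases j
  · rw [hstep _ 1 rfl]; fin_cases i <;> simp [companionMatrix]
  · rw [hstep _ 2 rfl]; fin_cases i <;> simp [companionMatrix]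
  · rw [hstep _ 3 rfl]; fin_cases i <;> simp [companionMatrix]
  · rw [hstep _ 4 rfl]; fin_cases i <;> simp [companionMatrix]
  · rw [hstep _ 5 rfl]; fin_cases i <;> simp [companionMatrix]
  · rw [hstep _ 6 rfl]; fin_cases i <;> simp [companionMatrix]
  · rw [hb]
    change b.repr (x * x ^ 6) i = _
    rw [hlast]
    fin_cases i <;> simp [companionMatrix]

theorem discr_of_basis_eq_pow {x : S} (b : Module.Basis (Fin 7) R S)
    (hb : ∀ i, b i = x ^ (i : ℕ)) (hx : x ^ 7 + 7 * x ^ 2 + 14 * x + 7 = 0) :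
    Algebra.discr R b = ((-(7 ^ 7 * 11 ^ 3 * 79) : ℤ) : R) := by
  have htrace : Algebra.traceMatrix R b = (Int.castRingHom R).mapMatrix powerSumMatrix := by
    ext i j
    rw [Algebra.traceMatrix_apply, Algebra.traceForm_apply, hb, hb, ← pow_add,
      Algebra.trace_eq_matrix_trace b, map_pow, leftMulMatrix_eq_companionMatrix b hb hx,
      RingHom.mapMatrix_apply, Matrix.map_apply, ← trace_companionMatrix_pow,
      ← RingHom.mapMatrix_apply, ← map_pow, RingHom.mapMatrix_apply,
      AddMonoidHom.map_trace (Int.castRingHom R)]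
  rw [Algebra.discr_def, htrace, ← RingHom.map_det, det_powerSumMatrix, eq_intCast]

theorem PowerBasis.discr_eq_of_root (B : PowerBasis R S) (hdim : B.dim = 7)
    (hx : B.gen ^ 7 + 7 * B.gen ^ 2 + 14 * B.gen + 7 = 0) :
    Algebra.discr R B.basis = ((-(7 ^ 7 * 11 ^ 3 * 79) : ℤ) : R) := by
  rw [← Algebra.discr_reindex R B.basis (finCongr hdim), ← Module.Basis.coe_reindex]
  exact discr_of_basis_eq_pow _ (by simp) hx

end PowerBasis

theorem monic_septic : (X ^ 7 + C 7 * X ^ 2 + C 14 * X + C 7 : ℤ[X]).Monic := by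
  monicity!

theorem natDegree_septic : (X ^ 7 + C 7 * X ^ 2 + C 14 * X + C 7 : ℤ[X]).natDegree = 7 := by
  compute_degree!

theorem isEisensteinAt_septic_s16 :
    (X ^ 7 + C 7 * X ^ 2 + C 14 * X + C 7 : ℤ[X]).IsEisensteinAt (Ideal.span {7}) where
  leading := by
    rw [monic_septic.leadingCoeff, Ideal.mem_span_singleton]
    norm_num
  mem {n} hn := by
    rw [natDegree_septic] at hn
    rw [Ideal.mem_span_singleton]
    interval_cases n <;> simp [coeff_X, coeff_X_pow]
  notMem := by
    rw [Ideal.span_singleton_pow, Ideal.mem_span_singleton]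
    simp

theorem root_septic_relation {f : ℤ[X]} (hf : f = X ^ 7 + C 7 * X ^ 2 + C 14 * X + C 7) :
    AdjoinRoot.root f ^ 7 + 7 * AdjoinRoot.root f ^ 2 + 14 * AdjoinRoot.root f + 7 = 0 := by
  calc
    _ = AdjoinRoot.mk f (X ^ 7 + C 7 * X ^ 2 + C 14 * X + C 7) := by
      simp only [map_add, map_mul, map_pow, AdjoinRoot.mk_X, map_ofNat]
    _ = AdjoinRoot.mk f f := congrArg _ hf.symm
    _ = 0 := AdjoinRoot.mk_self

theorem polyDisc_septic :
    polyDisc (X ^ 7 + C 7 * X ^ 2 + C 14 * X + C 7) = -(7 ^ 7 * 11 ^ 3 * 79) := by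
  rw [polyDisc, dif_pos monic_septic]
  refine PowerBasis.discr_eq_of_root (AdjoinRoot.powerBasis' monic_septic) natDegree_septic ?_
  rw [AdjoinRoot.powerBasis'_gen]
  exact root_septic_relation rfl

section NumberField

variable {K : Type*} [Field K] [NumberField K] {θ : 𝓞 K}

theorem intCast_discr {ι : Type*} [Fintype ι] [DecidableEq ι] (v : ι → 𝓞 K) :
    (Algebra.discr ℤ v : ℚ) = Algebra.discr ℚ (fun i => (v i : K)) := by
  rw [Algebra.discr_def, Algebra.discr_def, ← eq_intCast (Int.castRingHom ℚ), RingHom.map_det]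
  congr 1
  ext i j
  simp only [RingHom.mapMatrix_apply, Matrix.map_apply, Algebra.traceMatrix_apply,
    Algebra.traceForm_apply, ← map_mul]
  exact (Algebra.trace_localization ℤ (nonZeroDivisors ℤ) (v i * v j)).symm

theorem polyIndex_sq_mul_discr_s16 {n : ℕ} (b : Module.Basis (Fin n) ℤ (𝓞 K))
    (B : PowerBasis ℤ (Algebra.adjoin ℤ {θ})) (hdim : B.dim = n) (hgen : (B.gen : 𝓞 K) = θ) :
    (polyIndex θ : ℤ) ^ 2 * discr K = Algebra.discr ℤ (fun i : Fin n => θ ^ (i : ℕ)) := by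
  have hindex : polyIndex θ = (b.det (fun i : Fin n => θ ^ (i : ℕ))).natAbs := by
    rw [polyIndex, AddSubgroup.index_eq_natAbs_det b _ (B.basis.reindex (finCongr hdim))]
    congr 2
    ext i
    simp [hgen]
  rw [hindex, Int.natAbs_sq, Module.Basis.det_apply, ← NumberField.discr_eq_discr K b,
    ← Algebra.discr_of_matrix_vecMul, Module.Basis.toMatrix_map_vecMul]

theorem eleven_dvd_polyIndex (hmin : minpoly ℤ θ = X ^ 7 + C 7 * X ^ 2 + C 14 * X + C 7)
    (hθ : θ ^ 7 + 7 * θ ^ 2 + 14 * θ + 7 = 0) : 11 ∣ polyIndex θ := by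
  let q : 𝓞 K := θ ^ 5 + 6 * θ ^ 4 + 27 * θ ^ 3 + 108 * θ ^ 2 + 405 * θ + 1465
  obtain ⟨α, hα⟩ : ∃ α : 𝓞 K, 11 * α = (θ - 3) * q := by
    have hαint : IsIntegral (𝓞 K) (((θ - 3) * q : 𝓞 K) / 11 : K) := by
      refine ⟨X ^ 2 + C 469 * X + C (19 * q), by monicity!, ?_⟩
      have hq : (algebraMap (𝓞 K) K) ((θ - 3) ^ 2 * q + 5159 * (θ - 3) + 2299) = 0 := by
        rw [← map_zero (algebraMap (𝓞 K) K), ← hθ]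
        congr 1
        ring
      simp only [eval₂_add, eval₂_mul, eval₂_pow, eval₂_X, eval₂_C]
      simp only [map_add, map_mul, map_sub, map_pow, map_ofNat] at hq ⊢
      linear_combination (algebraMap (𝓞 K) K q) / 121 * hq
    obtain ⟨α, hα⟩ := IsIntegrallyClosed.isIntegral_iff.1 hαint
    refine ⟨α, FaithfulSMul.algebraMap_injective (𝓞 K) K ?_⟩
    rw [map_mul, hα, map_ofNat]
    field_simp
  have hα_notMem : α ∉ Algebra.adjoin ℤ {θ} := by
    intro hmem
    obtain ⟨p, rfl⟩ := Algebra.adjoin_singleton_eq_range_aeval ℤ θ ▸ hmem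
    let g : ℤ[X] := X ^ 6 + 3 * X ^ 5 + 9 * X ^ 4 + 27 * X ^ 3 + 81 * X ^ 2 + 250 * X - 4395
    have hdvd : X ^ 7 + C 7 * X ^ 2 + C 14 * X + C 7 ∣ g - 11 * p := by
      rw [← hmin]
      refine minpoly.isIntegrallyClosed_dvd (RingOfIntegers.isIntegral θ) ?_
      have hα' : 11 * aeval θ p = (θ - 3) * q := hα
      simp only [g, map_add, map_mul, map_sub, map_pow, map_ofNat, aeval_X, hα', q]
      ring
    have hmod := Polynomial.map_dvd (Int.castRingHom (ZMod 11)) hdvd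
    have h11 : (11 : (ZMod 11)[X]) = 0 := CharP.cast_eq_zero (ZMod 11)[X] 11
    rw [Polynomial.map_sub, Polynomial.map_mul, Polynomial.map_ofNat, h11, zero_mul,
      sub_zero] at hmod
    have hg : g.Monic := by unfold g; monicity!
    have hgdeg : g.natDegree = 6 := by unfold g; compute_degree!
    have : Fact (Nat.Prime 11) := ⟨by norm_num⟩
    refine (monic_septic.map _).not_dvd_of_natDegree_lt (hg.map _).ne_zero ?_ hmod
    rw [hg.natDegree_map, monic_septic.natDegree_map, hgdeg, natDegree_septic]
    norm_num
  have horder : addOrderOf (QuotientAddGroup.mk α :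
      𝓞 K ⧸ (Algebra.adjoin ℤ {θ}).toSubring.toAddSubgroup) = 11 := by
    have : Fact (Nat.Prime 11) := ⟨by norm_num⟩
    refine addOrderOf_eq_prime ?_ ?_
    · rw [← QuotientAddGroup.mk_nsmul, QuotientAddGroup.eq_zero_iff, nsmul_eq_mul]
      change (11 : ℕ) * α ∈ Algebra.adjoin ℤ {θ}
      rw [Nat.cast_ofNat, hα]
      have hmem := aeval_mem_adjoin_singleton ℤ θ (p := (X - 3) *
        (X ^ 5 + 6 * X ^ 4 + 27 * X ^ 3 + 108 * X ^ 2 + 405 * X + 1465))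
      simpa only [q, map_add, map_mul, map_sub, map_pow, map_ofNat, aeval_X] using hmem
    · rwa [Ne, QuotientAddGroup.eq_zero_iff]
  rw [polyIndex, AddSubgroup.index, ← horder]
  exact addOrderOf_dvd_natCard _

theorem not_seven_dvd_polyIndex (B : PowerBasis ℚ K) (hB : B.gen = θ)
    (hmin : minpoly ℤ θ = X ^ 7 + C 7 * X ^ 2 + C 14 * X + C 7)
    (hindex : polyIndex θ ≠ 0) : ¬ 7 ∣ polyIndex θ := by
  intro h7
  have hfin : Finite (𝓞 K ⧸ (Algebra.adjoin ℤ {θ}).toSubring.toAddSubgroup) :=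
    Nat.finite_of_card_ne_zero hindex
  have : Fact (Nat.Prime 7) := ⟨by norm_num⟩
  obtain ⟨z, hz⟩ := exists_prime_addOrderOf_dvd_card' 7 h7
  obtain ⟨z, rfl⟩ := QuotientAddGroup.mk_surjective z
  have hz0 : (QuotientAddGroup.mk z :
      𝓞 K ⧸ (Algebra.adjoin ℤ {θ}).toSubring.toAddSubgroup) ≠ 0 := by
    intro h
    simp [h] at hz
  have h7z := addOrderOf_nsmul_eq_zero (QuotientAddGroup.mk z :
      𝓞 K ⧸ (Algebra.adjoin ℤ {θ}).toSubring.toAddSubgroup)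
  rw [hz, ← QuotientAddGroup.mk_nsmul, QuotientAddGroup.eq_zero_iff] at h7z
  rw [Ne, QuotientAddGroup.eq_zero_iff] at hz0
  apply hz0
  have hadjoin (w : 𝓞 K) : (w : K) ∈ Algebra.adjoin ℤ {B.gen} ↔ w ∈ Algebra.adjoin ℤ {θ} := by
    have hmap := AlgHom.map_adjoin_singleton (IsScalarTower.toAlgHom ℤ (𝓞 K) K) θ
    rw [hB]
    change _ ∈ Algebra.adjoin ℤ {(IsScalarTower.toAlgHom ℤ (𝓞 K) K) θ} ↔ _
    rw [← hmap, Subalgebra.mem_map]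
    constructor
    · rintro ⟨v, hv, hvw⟩
      rwa [← RingOfIntegers.coe_injective hvw]
    · exact fun hw => ⟨w, hw, rfl⟩
  refine (hadjoin z).1 ?_
  have hminK : minpoly ℤ B.gen = X ^ 7 + C 7 * X ^ 2 + C 14 * X + C 7 := by
    rw [hB, ← hmin]
    exact minpoly.algebraMap_eq RingOfIntegers.coe_injective θ
  refine mem_adjoin_of_smul_prime_pow_smul_of_minpoly_isEisensteinAt (p := (7 : ℤ)) (n := 1)
    (by norm_num) (hB ▸ RingOfIntegers.isIntegral_coe θ) (RingOfIntegers.isIntegral_coe z) ?_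
    (hminK ▸ isEisensteinAt_septic_s16)
  have hcoe : (7 : ℤ) ^ 1 • (z : K) = (7 * z : 𝓞 K) := by
    rw [pow_one, zsmul_eq_mul, Int.cast_ofNat, ← map_ofNat (algebraMap (𝓞 K) K) 7]
    exact (map_mul (algebraMap (𝓞 K) K) 7 z).symm
  rw [hcoe]
  rw [nsmul_eq_mul] at h7z
  exact (hadjoin _).2 h7z

end NumberField

theorem eq_eleven_of_sq_mul_eq {n : ℕ} {d : ℤ} (h : (n : ℤ) ^ 2 * d = -(7 ^ 7 * 11 ^ 3 * 79))
    (h11 : 11 ∣ n) (h7 : ¬ 7 ∣ n) : n = 11 := by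
  obtain ⟨m, rfl⟩ := h11
  have hm : m ^ 2 ∣ 7 ^ 7 * 869 := by
    zify
    refine ⟨-d, ?_⟩
    push_cast at h
    linarith
  have hcop : (m ^ 2).Coprime (7 ^ 7) := by
    refine Nat.Coprime.pow _ _ (Nat.Coprime.symm ?_)
    exact (Nat.Prime.coprime_iff_not_dvd (by norm_num)).2 fun h => h7 (h.mul_left 11)
  have hm' := hcop.dvd_of_dvd_mul_left hm
  have hle : m ≤ 29 := by
    by_contra! hlt
    have := Nat.le_of_dvd (by norm_num) hm'
    nlinarith
  interval_cases m <;> revert hm' <;> decide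

theorem stmt_16 (f : Polynomial ℤ) (hf : f = X ^ 7 + C 7 * X ^ 2 + C 14 * X + C 7)
    (hirr : Irreducible f)
    (K : Type*) [Field K] [NumberField K] (θ : 𝓞 K)
    (hroot : Polynomial.aeval (θ : K) f = 0)
    (hgen : Algebra.adjoin ℚ {(θ : K)} = ⊤) :
    (polyDisc f).natAbs = 7 ^ 7 * 11 ^ 3 * 79 ∧ polyIndex θ = 11 := by
  subst hf
  refine ⟨by rw [polyDisc_septic]; norm_num, ?_⟩
  have hroot' : aeval θ (X ^ 7 + C 7 * X ^ 2 + C 14 * X + C 7 : ℤ[X]) = 0 := by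
    apply FaithfulSMul.algebraMap_injective (𝓞 K) K
    rw [← aeval_algebraMap_apply, map_zero]
    exact hroot
  have hθ : θ ^ 7 + 7 * θ ^ 2 + 14 * θ + 7 = 0 := by
    simpa only [map_add, map_mul, map_pow, aeval_X, eq_intCast, Int.cast_ofNat, map_ofNat]
      using hroot'
  have hint : IsIntegral ℤ θ := RingOfIntegers.isIntegral θ
  have hmin : minpoly ℤ θ = X ^ 7 + C 7 * X ^ 2 + C 14 * X + C 7 :=
    eq_of_monic_of_associated (minpoly.monic hint) monic_septic <|
      (minpoly.irreducible hint).associated_of_dvd hirr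
        (minpoly.isIntegrallyClosed_dvd hint hroot')
  have hminℚ : (minpoly ℚ (θ : K)).natDegree = 7 := by
    rw [minpoly.isIntegrallyClosed_eq_field_fractions ℚ K hint, hmin,
      monic_septic.natDegree_map, natDegree_septic]
  let B : PowerBasis ℚ K := PowerBasis.ofAdjoinEqTop
    (Algebra.IsIntegral.isIntegral (θ : K)) hgen
  have hBgen : B.gen = θ := PowerBasis.ofAdjoinEqTop_gen _ _
  have hBdim : B.dim = 7 := hminℚ
  let B' := Algebra.adjoin.powerBasis' hint
  have hrank : Module.finrank ℤ (𝓞 K) = 7 := by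
    rw [RingOfIntegers.rank, B.finrank, hBdim]
  let b : Module.Basis (Fin 7) ℤ (𝓞 K) := Module.finBasisOfFinrankEq ℤ (𝓞 K) hrank
  have hdisc := polyIndex_sq_mul_discr_s16 b B'
    (by rw [Algebra.adjoin.powerBasis'_dim, hmin, natDegree_septic])
    (by rw [Algebra.adjoin.powerBasis'_gen])
  have hdisc' : Algebra.discr ℤ (fun i : Fin 7 => θ ^ (i : ℕ)) = -(7 ^ 7 * 11 ^ 3 * 79) := by
    have hθK : (θ : K) ^ 7 + 7 * (θ : K) ^ 2 + 14 * (θ : K) + 7 = 0 := by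
      simpa only [map_add, map_mul, map_pow, aeval_X, map_ofNat] using hroot
    have h := discr_of_basis_eq_pow (x := (θ : K)) (B.basis.reindex (finCongr hBdim))
      (by simp [hBgen]) hθK
    apply Int.cast_injective (α := ℚ)
    refine (intCast_discr _).trans (Eq.trans ?_ h)
    congr 1
    ext i
    simp [hBgen]
  rw [hdisc'] at hdisc
  have hne : polyIndex θ ≠ 0 := by
    intro h
    norm_num [h] at hdisc
  exact eq_eleven_of_sq_mul_eq hdisc (eleven_dvd_polyIndex hmin hθ)
    (not_seven_dvd_polyIndex B hBgen hmin hne)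
end

section
/- Let c be an integer and suppose there exists a prime p and a positive integer k such that p^k exactly divides c (p^k | c and p^{k+1} ∤ c) and gcd(k, n) = 1, where n ≥ 3. Then the polynomial f(x) = x^n + c·(x^2 + 2x + 1) = x^n + c·x^2 + 2c·x + c ∈ ℤ[x] is irreducible over ℚ. -/
open Polynomial NumberField

/-- The product of the relations `x ^ n = -c * (x + 1) ^ 2` over the complex roots `x` of `g`. -/
theorem eval_zero_pow_of_dvd {n : ℕ} {c : ℤ} {g : ℤ[X]} (hg : g.Monic)
    (hdvd : g ∣ X ^ n + C c * (X + 1) ^ 2) :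
    ((-1) ^ g.natDegree * g.eval 0) ^ n =
      (-c) ^ g.natDegree * ((-1) ^ g.natDegree * g.eval (-1)) ^ 2 := by
  set G := g.map (Int.castRingHom ℂ) with hG
  have hsplit : G.Splits := IsAlgClosed.splits G
  have hGm : G.Monic := hg.map _
  have hcard : G.roots.card = g.natDegree := by
    rw [← hsplit.natDegree_eq_card_roots, hG, hg.natDegree_map]
  have heval (z : ℤ) :
      (((-1) ^ g.natDegree * g.eval z : ℤ) : ℂ) = (G.roots.map fun x : ℂ => x - z).prod := by
    have h1 : ((g.eval z : ℤ) : ℂ) = G.eval (z : ℂ) :=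
      (eval_map_apply (Int.castRingHom ℂ) z).symm
    push_cast
    rw [h1, hsplit.eval_eq_prod_roots_of_monic hGm, ← hcard]
    have h2 : (fun x : ℂ => x - z) = fun x => (-1) * ((z : ℂ) - x) := by
      funext x; ring
    rw [h2, Multiset.prod_map_mul]
    simp
  have hroot : ∀ x ∈ G.roots, (x - ((0 : ℤ) : ℂ)) ^ n = -c * (x - ((-1 : ℤ) : ℂ)) ^ 2 := by
    intro x hx
    have hx0 : G.eval x = 0 := (mem_roots'.1 hx).2
    have h := eval_dvd (x := x) (Polynomial.map_dvd (Int.castRingHom ℂ) hdvd)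
    rw [← hG, hx0, zero_dvd_iff] at h
    simp at h
    push_cast
    linear_combination h
  have key : (((-1) ^ g.natDegree * g.eval 0 : ℤ) : ℂ) ^ n =
      (-c) ^ g.natDegree * (((-1) ^ g.natDegree * g.eval (-1) : ℤ) : ℂ) ^ 2 := by
    rw [heval, heval, ← Multiset.prod_map_pow, ← Multiset.prod_map_pow,
      Multiset.map_congr rfl hroot, Multiset.prod_map_mul]
    simp [hcard]
  exact_mod_cast key

theorem dvd_natDegree_of_monic_of_dvd {n : ℕ} (hn : n ≠ 0) {c : ℤ} {p k : ℕ} (hp : p.Prime)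
    (hdvd : (p : ℤ) ^ k ∣ c) (hexact : ¬ (p : ℤ) ^ (k + 1) ∣ c) (hgcd : Nat.gcd k n = 1)
    {g : ℤ[X]} (hg : g.Monic) (hgf : g ∣ X ^ n + C c * (X + 1) ^ 2) :
    n ∣ g.natDegree := by
  have hunit : IsUnit (g.eval (-1)) := by
    refine isUnit_of_dvd_unit (eval_dvd (x := -1) hgf) ?_
    simpa using isUnit_neg_one.pow n
  have h := congrArg Int.natAbs (eval_zero_pow_of_dvd hg hgf)
  simp only [Int.natAbs_mul, Int.natAbs_pow, Int.natAbs_neg, Int.natAbs_one, one_pow, one_mul,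
    Int.isUnit_iff_natAbs_eq.1 hunit, mul_one] at h
  have hc : emultiplicity p c.natAbs = k := by
    rw [Int.emultiplicity_natAbs]
    exact emultiplicity_eq_coe.2 ⟨hdvd, hexact⟩
  have h1 := congrArg (emultiplicity p) h
  rw [emultiplicity_pow hp.prime, emultiplicity_pow hp.prime, hc] at h1
  have hfin : emultiplicity p (g.eval 0).natAbs ≠ ⊤ := by
    intro htop
    rw [htop, ENat.mul_top (by exact_mod_cast hn)] at h1
    exact ENat.natCast_ne_top (g.natDegree * k) (by exact_mod_cast h1.symm)
  obtain ⟨m, hm⟩ := ENat.ne_top_iff_exists.1 hfin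
  rw [← hm] at h1
  have h2 : n * m = g.natDegree * k := by exact_mod_cast h1
  exact (Nat.Coprime.symm hgcd).dvd_of_dvd_mul_right ⟨m, h2.symm⟩

theorem stmt_19 (n : ℕ) (hn : 3 ≤ n) (c : ℤ)
    (p : ℕ) (hp : p.Prime) (k : ℕ) (hk : 1 ≤ k)
    (hdvd : (p : ℤ) ^ k ∣ c) (hexact : ¬ (p : ℤ) ^ (k + 1) ∣ c)
    (hgcd : Nat.gcd k n = 1)
    (f : Polynomial ℤ) (hf : f = X ^ n + C c * X ^ 2 + C (2 * c) * X + C c) :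
    Irreducible (f.map (Int.castRingHom ℚ)) := by
  have hf' : f = X ^ n + C c * (X + 1) ^ 2 := by
    rw [hf, C_mul, C_ofNat]; ring
  have hlt : (C c * (X + 1) ^ 2 : ℤ[X]).natDegree < n := by
    refine lt_of_le_of_lt ?_ hn
    compute_degree
  have hdeg : (C c * (X + 1) ^ 2 : ℤ[X]).degree < n :=
    lt_of_le_of_lt degree_le_natDegree (by exact_mod_cast hlt)
  have hmonic : f.Monic := hf' ▸ monic_X_pow_add hdeg
  have hfn : f.natDegree = n := by
    rw [hf', natDegree_add_eq_left_of_natDegree_lt (by simpa only [natDegree_X_pow] using hlt),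
      natDegree_X_pow]
  have hf1 : f ≠ 1 := by
    rintro rfl
    simp at hfn
    lia
  refine (hmonic.irreducible_iff_irreducible_map_fraction_map (K := ℚ)).1 ?_
  refine (hmonic.irreducible_iff_natDegree).2 ⟨hf1, fun g h hg hh hgh => ?_⟩
  have hdvd_g : n ∣ g.natDegree :=
    dvd_natDegree_of_monic_of_dvd (by lia) hp hdvd hexact hgcd hg (hf' ▸ Dvd.intro _ hgh)
  have hsum : g.natDegree + h.natDegree = n := by
    rw [← hg.natDegree_mul hh, hgh, hfn]
  rcases Nat.eq_zero_or_pos g.natDegree with h0 | h0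
  · exact Or.inl h0
  · have := Nat.le_of_dvd h0 hdvd_g
    right
    lia
end
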